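/- For every integer n ≥ 1, Ramanujan's tau function satisfies τ(n) = (200/3)·(σ_{(7,3)}(n) + σ_{(3,7)}(n)) − 294·σ_{(5,5)}(n) − (1/396)·σ_11(n) + (5/6)·σ_7(n) − (137/36)·σ_5(n) − (19/9)·σ_3(n) + (1205/198)·σ_1(n), as an identity of rational numbers. -/

import Mathlib

open Finset

/-- Divisor power sum `σ_k(n) = ∑_{d ∣ n} d^k`. -/
def sigmaPow (k n : ℕ) : ℕ := ∑ d ∈ n.divisors, d ^ k

/-- Depth-two multiple divisor sum `σ_{(s,t)}(n)`: the sum of `m1^s · m2^t` over all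
quadruples of positive integers `((m1, m2), (n1, n2))` with `m1·n1 + m2·n2 = n` and `n1 < n2`. -/
def sigmaPow2 (s t n : ℕ) : ℕ :=
  ∑ p ∈ ((Finset.Icc 1 n ×ˢ Finset.Icc 1 n) ×ˢ (Finset.Icc 1 n ×ˢ Finset.Icc 1 n)).filter
      (fun p => p.1.1 * p.2.1 + p.1.2 * p.2.2 = n ∧ p.2.1 < p.2.2),
    p.1.1 ^ s * p.1.2 ^ t

/-- Ramanujan's tau function: the coefficient of `q^n` in `q · ∏_{k=1}^{n} (1 - q^k)^24`. -/
noncomputable def ramanujanTau (n : ℕ) : ℤ :=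
  ((Polynomial.X : Polynomial ℤ) * ∏ k ∈ Finset.Icc 1 n, (1 - Polynomial.X ^ k) ^ 24).coeff n

/-- Iterated complex derivatives preserve locally uniform convergence on open sets. -/
theorem iteratedDeriv_tendstoLocallyUniformlyOn {ι : Type*} {φ : Filter ι}
    {F : ι → ℂ → ℂ} {f : ℂ → ℂ} {U : Set ℂ} (hU : IsOpen U)
    (hf : TendstoLocallyUniformlyOn F f φ U) (hF : ∀ i, DifferentiableOn ℂ (F i) U) (n : ℕ) :
    TendstoLocallyUniformlyOn (fun i => iteratedDeriv n (F i)) (iteratedDeriv n f) φ U ∧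
      ∀ i, DifferentiableOn ℂ (iteratedDeriv n (F i)) U := by
  induction n with
  | zero => simpa using ⟨hf, hF⟩
  | succ n ih =>
    simp only [iteratedDeriv_succ]
    exact ⟨ih.1.deriv (.of_forall ih.2) hU, fun i => (ih.2 i).deriv hU⟩

theorem iteratedDeriv_eval_zero (p : Polynomial ℂ) (n : ℕ) :
    iteratedDeriv n (fun x => p.eval x) 0 = n.factorial * p.coeff n := by
  have h : ∀ m, iteratedDeriv m (fun x => p.eval x) =
      fun x => (Polynomial.derivative^[m] p).eval x := by
    intro m
    induction m with
    | zero => simp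
    | succ m ih =>
      ext x
      rw [iteratedDeriv_succ, ih, Polynomial.deriv, Function.iterate_succ_apply']
  simp only [h]
  rw [← Polynomial.coeff_zero_eq_eval_zero, Polynomial.coeff_iterate_derivative]
  simp [Nat.descFactorial_self]

/-- The polynomial truncations of the product expansion of `Δ`. -/
noncomputable def deltaTrunc (R : Type*) [CommRing R] (N : ℕ) : Polynomial R :=
  Polynomial.X * ∏ k ∈ Finset.Icc 1 N, (1 - Polynomial.X ^ k) ^ 24

theorem coeff_deltaTrunc_of_le {R : Type*} [CommRing R] {n N : ℕ} (h : n ≤ N) :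
    (deltaTrunc R N).coeff n = (deltaTrunc R n).coeff n := by
  induction N, h using Nat.le_induction with
  | base => rfl
  | succ N hN ih =>
    rw [← ih, deltaTrunc, Finset.prod_Icc_succ_top (by omega), ← mul_assoc, ← deltaTrunc]
    have hd : (Polynomial.X : Polynomial R) ^ (N + 1) ∣ (1 - Polynomial.X ^ (N + 1)) ^ 24 - 1 := by
      have := sub_dvd_pow_sub_pow (1 - (Polynomial.X : Polynomial R) ^ (N + 1)) 1 24
      simpa using this
    obtain ⟨r, hr⟩ := hd
    rw [eq_add_of_sub_eq hr, mul_add, mul_one, Polynomial.coeff_add, add_eq_right,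
      mul_comm, mul_assoc, Polynomial.coeff_X_pow_mul', if_neg (by omega)]

theorem qExpansion_discriminant_coeff (n : ℕ) :
    (UpperHalfPlane.qExpansion 1 ModularForm.discriminant).coeff n = (ramanujanTau n : ℂ) := by
  have hopen : IsOpen (Metric.ball (0 : ℂ) 1) := Metric.isOpen_ball
  have h0 : (0 : ℂ) ∈ Metric.ball (0 : ℂ) 1 := by simp
  have h1 : TendstoLocallyUniformlyOn (fun (N : ℕ) (q : ℂ) => ∏ i ∈ range N, (1 - q ^ (i + 1)))
      (fun q => ∏' i : ℕ, (1 - q ^ (i + 1))) Filter.atTop (Metric.ball (0 : ℂ) 1) := by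
    have := ModularForm.multipliableLocallyUniformlyOn_one_sub_pow.hasProdLocallyUniformlyOn
    intro u hu x hx
    obtain ⟨t, ht, h⟩ := this u hu x hx
    exact ⟨t, ht, Filter.tendsto_finset_range.eventually h⟩
  have hc1 := ModularForm.differentiableOn_tprod_one_sub_pow.continuousOn
  have hpow : ∀ m : ℕ, TendstoLocallyUniformlyOn
      (fun (N : ℕ) (q : ℂ) => q * (∏ i ∈ range N, (1 - q ^ (i + 1))) ^ m)
      (fun q => q * (∏' i : ℕ, (1 - q ^ (i + 1))) ^ m) Filter.atTop (Metric.ball (0 : ℂ) 1) := by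
    intro m
    induction m with
    | zero =>
      simp only [pow_zero]
      intro u hu x hx
      exact ⟨Set.univ, Filter.univ_mem, .of_forall fun _ _ _ => refl_mem_uniformity hu⟩
    | succ m ih =>
      simp only [pow_succ, ← mul_assoc]
      exact ih.mul₀ h1 (continuousOn_id.mul (hc1.pow m)) hc1
  have heval : ∀ (N : ℕ) (q : ℂ), q * (∏ i ∈ range N, (1 - q ^ (i + 1))) ^ 24 =
      (deltaTrunc ℂ N).eval q := by
    intro N q
    rw [deltaTrunc, Finset.range_eq_Ico, Finset.prod_Ico_add' (fun i => 1 - q ^ i) 0 N 1, zero_add,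
      Finset.Ico_add_one_right_eq_Icc, ← Finset.prod_pow]
    simp [Polynomial.eval_prod]
  have h2 := hpow 24
  simp only [heval] at h2
  have h3 := ((iteratedDeriv_tendstoLocallyUniformlyOn hopen h2
    (fun N => (deltaTrunc ℂ N).differentiable.differentiableOn) n).1).tendsto_at h0
  simp only [iteratedDeriv_eval_zero] at h3
  have h4 : Filter.Tendsto (fun N => (n.factorial : ℂ) * (deltaTrunc ℂ N).coeff n) Filter.atTop
      (nhds ((n.factorial : ℂ) * (deltaTrunc ℂ n).coeff n)) := by
    refine tendsto_const_nhds.congr' ?_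
    filter_upwards [Filter.eventually_ge_atTop n] with N hN
    rw [coeff_deltaTrunc_of_le hN]
  have h5 := tendsto_nhds_unique h3 h4
  have h6 : UpperHalfPlane.cuspFunction 1 ModularForm.discriminant =ᶠ[nhds 0]
      fun q => q * (∏' i : ℕ, (1 - q ^ (i + 1))) ^ 24 := by
    filter_upwards [hopen.mem_nhds h0] with q hq
    rw [ModularForm.discriminant_cuspFunction_eqOn hq,
      ← (ModularForm.multipliable_one_sub_pow (by simpa using hq)).tprod_pow]
  have h7 : (deltaTrunc ℂ n).coeff n = (ramanujanTau n : ℂ) := by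
    have : deltaTrunc ℂ n = (deltaTrunc ℤ n).map (Int.castRingHom ℂ) := by
      simp [deltaTrunc, Polynomial.map_prod]
    rw [this, Polynomial.coeff_map]
    rfl
  rw [UpperHalfPlane.qExpansion_coeff, h6.iteratedDeriv_eq, h5, h7,
    inv_mul_cancel_left₀ (by exact_mod_cast n.factorial_ne_zero)]

/-- Additive convolution of two divisor power sums. -/
def sigmaConv (s t n : ℕ) : ℕ := ∑ p ∈ antidiagonal n, sigmaPow s p.1 * sigmaPow t p.2

theorem sigmaPow_eq_sum_box (s : ℕ) {a n : ℕ} (h : a ≤ n) :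
    sigmaPow s a = ∑ m ∈ Icc 1 n, ∑ k ∈ Icc 1 n, if m * k = a then m ^ s else 0 := by
  have : ∀ m ∈ Icc 1 n, (∑ k ∈ Icc 1 n, if m * k = a then m ^ s else 0) =
      if m ∈ a.divisors then m ^ s else 0 := by
    intro m hm
    rw [mem_Icc] at hm
    split_ifs with hd
    · obtain ⟨⟨k, rfl⟩, h0⟩ := Nat.mem_divisors.mp hd
      have hk : k ≠ 0 := by rintro rfl; simp at h0
      rw [Finset.sum_eq_single k]
      · simp
      · intro j _ hj
        rw [if_neg]
        exact fun he => hj (Nat.eq_of_mul_eq_mul_left (by omega) he)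
      · intro hk'
        exact absurd (mem_Icc.mpr ⟨by omega, le_trans (Nat.le_mul_of_pos_left k (by omega)) h⟩) hk'
    · refine Finset.sum_eq_zero fun k hk => if_neg ?_
      rintro rfl
      rw [mem_Icc] at hk
      exact hd (Nat.mem_divisors.mpr ⟨dvd_mul_right _ _, Nat.mul_ne_zero (by omega) (by omega)⟩)
  rw [Finset.sum_congr rfl this, ← Finset.sum_filter, sigmaPow]
  refine Finset.sum_congr ?_ fun _ _ => rfl
  ext m
  simp only [mem_filter, mem_Icc]
  refine ⟨fun hm => ⟨⟨Nat.pos_of_mem_divisors hm, (Nat.divisor_le hm).trans h⟩, hm⟩, fun hm => hm.2⟩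

/-- A sum over all solutions of `m1·n1 + m2·n2 = n` in positive integers subject to `P n1 n2`. -/
def quadSum (P : ℕ → ℕ → Prop) [DecidableRel P] (s t n : ℕ) : ℕ :=
  ∑ m1 ∈ Icc 1 n, ∑ m2 ∈ Icc 1 n, ∑ n1 ∈ Icc 1 n, ∑ n2 ∈ Icc 1 n,
    if m1 * n1 + m2 * n2 = n ∧ P n1 n2 then m1 ^ s * m2 ^ t else 0

theorem sigmaPow2_eq_quadSum (s t n : ℕ) : sigmaPow2 s t n = quadSum (· < ·) s t n := by
  simp only [sigmaPow2, quadSum, Finset.sum_filter, Finset.sum_product]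

theorem sigmaPow2_eq_quadSum_swap (s t n : ℕ) : sigmaPow2 t s n = quadSum (· > ·) s t n := by
  rw [sigmaPow2_eq_quadSum, quadSum, Finset.sum_comm, quadSum]
  refine Finset.sum_congr rfl fun m1 _ => Finset.sum_congr rfl fun m2 _ => ?_
  rw [Finset.sum_comm]
  refine Finset.sum_congr rfl fun n1 _ => Finset.sum_congr rfl fun n2 _ => ?_
  simp only [add_comm (m2 * n2), mul_comm (m2 ^ t), gt_iff_lt]

theorem sigmaConv_eq_quadSum (s t n : ℕ) : sigmaConv s t n = quadSum (fun _ _ => True) s t n := by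
  have : ∀ p ∈ antidiagonal n, sigmaPow s p.1 * sigmaPow t p.2 =
      ∑ m1 ∈ Icc 1 n, ∑ m2 ∈ Icc 1 n, ∑ n1 ∈ Icc 1 n, ∑ n2 ∈ Icc 1 n,
        if p = (m1 * n1, m2 * n2) then m1 ^ s * m2 ^ t else 0 := by
    rintro ⟨a, b⟩ hp
    rw [HasAntidiagonal.mem_antidiagonal] at hp
    simp only at hp
    rw [sigmaPow_eq_sum_box s (show a ≤ n by omega), sigmaPow_eq_sum_box t (show b ≤ n by omega),
      Finset.sum_mul_sum]
    refine Finset.sum_congr rfl fun m1 _ => Finset.sum_congr rfl fun m2 _ => ?_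
    rw [Finset.sum_mul_sum]
    refine Finset.sum_congr rfl fun n1 _ => Finset.sum_congr rfl fun n2 _ => ?_
    simp only [Prod.mk.injEq, eq_comm (a := a), eq_comm (a := b)]
    split_ifs <;> simp_all
  rw [sigmaConv, Finset.sum_congr rfl this, Finset.sum_comm, quadSum]
  refine Finset.sum_congr rfl fun m1 _ => ?_
  rw [Finset.sum_comm]
  refine Finset.sum_congr rfl fun m2 _ => ?_
  rw [Finset.sum_comm]
  refine Finset.sum_congr rfl fun n1 _ => ?_
  rw [Finset.sum_comm]
  refine Finset.sum_congr rfl fun n2 _ => ?_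
  rw [Finset.sum_ite_eq']
  simp

theorem sigmaConv_eq_add (s t n : ℕ) :
    sigmaConv s t n = sigmaPow2 s t n + sigmaPow2 t s n + quadSum (· = ·) s t n := by
  rw [sigmaConv_eq_quadSum, sigmaPow2_eq_quadSum, sigmaPow2_eq_quadSum_swap]
  simp only [quadSum, ← Finset.sum_add_distrib]
  refine Finset.sum_congr rfl fun m1 _ => Finset.sum_congr rfl fun m2 _ =>
    Finset.sum_congr rfl fun n1 _ => Finset.sum_congr rfl fun n2 _ => ?_
  rcases lt_trichotomy n1 n2 with h | h | h
  · simp [h, h.ne, h.not_gt]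
  · simp [h]
  · simp [h, h.ne', h.not_gt]

theorem quadSum_eq_eq_sum_divisors (s t n : ℕ) :
    quadSum (· = ·) s t n = ∑ d ∈ n.divisors, ∑ m ∈ Ico 1 d, m ^ s * (d - m) ^ t := by
  rcases Nat.eq_zero_or_pos n with rfl | hn
  · simp [quadSum]
  have h1 : quadSum (· = ·) s t n = ∑ m1 ∈ Icc 1 n, ∑ m2 ∈ Icc 1 n,
      if m1 + m2 ∣ n then m1 ^ s * m2 ^ t else 0 := by
    refine Finset.sum_congr rfl fun m1 h1 => Finset.sum_congr rfl fun m2 h2 => ?_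
    rw [mem_Icc] at h1 h2
    have : ∀ n1 ∈ Icc 1 n, (∑ n2 ∈ Icc 1 n,
        if m1 * n1 + m2 * n2 = n ∧ n1 = n2 then m1 ^ s * m2 ^ t else 0) =
        if (m1 + m2) * n1 = n then m1 ^ s * m2 ^ t else 0 := by
      intro n1 hn1
      rw [Finset.sum_eq_single_of_mem n1 hn1 fun j _ hj => if_neg fun h => hj h.2.symm]
      simp [add_mul]
    rw [Finset.sum_congr rfl this]
    split_ifs with hd
    · obtain ⟨k, hk⟩ := hd
      have hk0 : k ≠ 0 := by rintro rfl; omega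
      rw [Finset.sum_eq_single_of_mem k, if_pos hk.symm]
      · rw [mem_Icc, hk]
        exact ⟨by omega, Nat.le_mul_of_pos_left k (by omega)⟩
      · intro j _ hj
        refine if_neg fun he => hj (Nat.eq_of_mul_eq_mul_left (by omega) (he.trans hk))
    · exact Finset.sum_eq_zero fun k _ => if_neg fun h => hd ⟨k, h.symm⟩
  rw [h1, ← Finset.sum_product', ← Finset.sum_filter, Finset.sum_sigma']
  refine Finset.sum_bij' (fun p _ => ⟨p.1 + p.2, p.1⟩) (fun x _ => (x.2, x.1 - x.2)) ?_ ?_ ?_ ?_ ?_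
  · rintro ⟨a, b⟩ h
    simp only [mem_filter, mem_product, mem_Icc, mem_sigma, Nat.mem_divisors, mem_Ico] at h ⊢
    exact ⟨⟨h.2, by omega⟩, by omega, by omega⟩
  · rintro ⟨d, m⟩ h
    simp only [mem_filter, mem_product, mem_Icc, mem_sigma, Nat.mem_divisors, mem_Ico] at h ⊢
    have := Nat.le_of_dvd hn h.1.1
    exact ⟨by omega, by rw [Nat.add_sub_cancel' (by omega)]; exact h.1.1⟩
  · rintro ⟨a, b⟩ h
    simp
  · rintro ⟨d, m⟩ h
    simp only [mem_sigma, mem_Ico] at h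
    simp only [Sigma.mk.injEq, heq_eq_eq, and_true]
    omega
  · rintro ⟨a, b⟩ h
    simp

theorem sum_Ico_pow_closed_forms {N : ℕ} (hN : 1 ≤ N) :
    (∑ m ∈ Ico 1 N, (m : ℚ) ^ 5 = N ^ 6 / 6 - N ^ 5 / 2 + 5 * N ^ 4 / 12 - N ^ 2 / 12) ∧
    (∑ m ∈ Ico 1 N, (m : ℚ) ^ 6 = N ^ 7 / 7 - N ^ 6 / 2 + N ^ 5 / 2 - N ^ 3 / 6 + N / 42) ∧
    (∑ m ∈ Ico 1 N, (m : ℚ) ^ 7 =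
      N ^ 8 / 8 - N ^ 7 / 2 + 7 * N ^ 6 / 12 - 7 * N ^ 4 / 24 + N ^ 2 / 12) ∧
    (∑ m ∈ Ico 1 N, (m : ℚ) ^ 8 =
      N ^ 9 / 9 - N ^ 8 / 2 + 2 * N ^ 7 / 3 - 7 * N ^ 5 / 15 + 2 * N ^ 3 / 9 - N / 30) ∧
    (∑ m ∈ Ico 1 N, (m : ℚ) ^ 9 =
      N ^ 10 / 10 - N ^ 9 / 2 + 3 * N ^ 8 / 4 - 7 * N ^ 6 / 10 + N ^ 4 / 2 - 3 * N ^ 2 / 20) ∧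
    (∑ m ∈ Ico 1 N, (m : ℚ) ^ 10 =
      N ^ 11 / 11 - N ^ 10 / 2 + 5 * N ^ 9 / 6 - N ^ 7 + N ^ 5 - N ^ 3 / 2 + 5 * N / 66) := by
  induction N, hN using Nat.le_induction with
  | base => norm_num
  | succ N hN ih =>
    obtain ⟨h5, h6, h7, h8, h9, h10⟩ := ih
    simp only [Finset.sum_Ico_succ_top hN, h5, h6, h7, h8, h9, h10]
    push_cast
    refine ⟨?_, ?_, ?_, ?_, ?_, ?_⟩ <;> ring

theorem sum_Ico_pow_mul_sub_pow {d : ℕ} (hd : 1 ≤ d) :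
    200 / 3 * ((∑ m ∈ Ico 1 d, m ^ 7 * (d - m) ^ 3 : ℕ) : ℚ)
        - 147 * ((∑ m ∈ Ico 1 d, m ^ 5 * (d - m) ^ 5 : ℕ) : ℚ) =
      -(1 / 396) * (d : ℚ) ^ 11 + 5 / 9 * (d : ℚ) ^ 7 - 79 / 18 * (d : ℚ) ^ 5
        - 9 / 4 * (d : ℚ) ^ 3 + 1205 / 198 * (d : ℚ) ^ 1 := by
  obtain ⟨h5, h6, h7, h8, h9, h10⟩ := sum_Ico_pow_closed_forms hd
  have e1 : ((∑ m ∈ Ico 1 d, m ^ 7 * (d - m) ^ 3 : ℕ) : ℚ) =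
      ∑ m ∈ Ico 1 d, ((d : ℚ) ^ 3 * (m : ℚ) ^ 7 + -(3 * (d : ℚ) ^ 2) * (m : ℚ) ^ 8
        + 3 * (d : ℚ) * (m : ℚ) ^ 9 + (-1) * (m : ℚ) ^ 10) := by
    rw [Nat.cast_sum]
    refine Finset.sum_congr rfl fun m hm => ?_
    rw [Nat.cast_mul, Nat.cast_pow, Nat.cast_pow, Nat.cast_sub (mem_Ico.mp hm).2.le]
    ring
  have e2 : ((∑ m ∈ Ico 1 d, m ^ 5 * (d - m) ^ 5 : ℕ) : ℚ) =
      ∑ m ∈ Ico 1 d, ((d : ℚ) ^ 5 * (m : ℚ) ^ 5 + -(5 * (d : ℚ) ^ 4) * (m : ℚ) ^ 6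
        + 10 * (d : ℚ) ^ 3 * (m : ℚ) ^ 7 + -(10 * (d : ℚ) ^ 2) * (m : ℚ) ^ 8
        + 5 * (d : ℚ) * (m : ℚ) ^ 9 + (-1) * (m : ℚ) ^ 10) := by
    rw [Nat.cast_sum]
    refine Finset.sum_congr rfl fun m hm => ?_
    rw [Nat.cast_mul, Nat.cast_pow, Nat.cast_pow, Nat.cast_sub (mem_Ico.mp hm).2.le]
    ring
  rw [e1, e2]
  simp only [Finset.sum_add_distrib, ← Finset.mul_sum, h5, h6, h7, h8, h9, h10]
  ring

theorem quadSum_eq_combination (n : ℕ) :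
    200 / 3 * (quadSum (· = ·) 7 3 n : ℚ) - 147 * (quadSum (· = ·) 5 5 n : ℚ) =
      -(1 / 396) * (sigmaPow 11 n : ℚ) + 5 / 9 * (sigmaPow 7 n : ℚ)
        - 79 / 18 * (sigmaPow 5 n : ℚ) - 9 / 4 * (sigmaPow 3 n : ℚ)
        + 1205 / 198 * (sigmaPow 1 n : ℚ) := by
  simp only [quadSum_eq_eq_sum_divisors, sigmaPow]
  rw [Nat.cast_sum, Nat.cast_sum]
  push_cast only [Nat.cast_sum, Nat.cast_pow]
  simp only [Finset.mul_sum, ← Finset.sum_add_distrib, ← Finset.sum_sub_distrib]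
  refine Finset.sum_congr rfl fun d hd => ?_
  simpa [Finset.mul_sum] using sum_Ico_pow_mul_sub_pow (Nat.pos_of_mem_divisors hd)

open ModularForm EisensteinSeries MatrixGroups UpperHalfPlane in
/-- The Eisenstein series of weight eight is the square of the one of weight four. -/
theorem E_eight_qExpansion :
    qExpansion 1 (E (by norm_num : 3 ≤ 8)) = qExpansion 1 E₄ ^ 2 := by
  let f : ModularForm 𝒮ℒ (8 : ℕ) :=
    E (by norm_num : 3 ≤ 8) - ModularForm.mcast (by decide) (E₄.pow 2)
  have hq : qExpansion 1 f = qExpansion 1 (E (by norm_num : 3 ≤ 8)) - qExpansion 1 E₄ ^ 2 := by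
    simp only [f, FunLike.coe_sub, coe_mcast,
      ModularForm.qExpansion_sub one_pos one_mem_strictPeriods_SL,
      ModularForm.qExpansion_pow one_pos one_mem_strictPeriods_SL]
  have hf : f = 0 := by
    refine sturm_bound_levelOne_nat ?_
    refine lt_of_lt_of_le (b := ((1 : ℕ) : ℕ∞)) (by norm_num) (PowerSeries.nat_le_order _ _ ?_)
    intro i hi
    obtain rfl : i = 0 := by omega
    rw [hq]
    have h8 := E_qExpansion_coeff_zero (by norm_num : 3 ≤ 8) ⟨4, rfl⟩
    have h4 := E_qExpansion_coeff_zero (by norm_num : 3 ≤ 4) ⟨2, rfl⟩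
    rw [PowerSeries.coeff_zero_eq_constantCoeff] at h4 h8
    simp [h4, h8]
  have h0 : qExpansion 1 f = 0 := by rw [hf]; exact qExpansion_zero 1
  exact sub_eq_zero.mp (hq ▸ h0)

open ModularForm EisensteinSeries MatrixGroups UpperHalfPlane in
theorem discriminant_qExpansion :
    (1728 : ℂ) • qExpansion 1 discriminant =
      qExpansion 1 E₄ * qExpansion 1 (E (by norm_num : 3 ≤ 8)) -
        qExpansion 1 E₆ * qExpansion 1 E₆ := by
  let f : ModularForm 𝒮ℒ 12 :=
    ModularForm.mcast (by decide) (E₄.pow 3) - ModularForm.mcast (by decide) (E₆.pow 2)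
  have hf : ((1728 : ℂ) • CuspForm.discriminant : ℍ → ℂ) = f := by
    ext z
    simp only [f, coe_mcast, ModularForm.coe_pow, sub_apply, Pi.pow_apply, Pi.smul_apply, smul_eq_mul,
      CuspForm.coe_discriminant, discriminant_eq_E₄_cube_sub_E₆_sq]
    ring
  rw [E_eight_qExpansion, ← CuspForm.coe_discriminant,
    ← ModularForm.qExpansion_smul one_pos one_mem_strictPeriods_SL, hf]
  simp only [f, FunLike.coe_sub, coe_mcast,
    ModularForm.qExpansion_sub one_pos one_mem_strictPeriods_SL,
    ModularForm.qExpansion_pow one_pos one_mem_strictPeriods_SL]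
  ring

theorem sigma_eq_sigmaPow (k n : ℕ) : ArithmeticFunction.sigma k n = sigmaPow k n :=
  ArithmeticFunction.sigma_apply

open ModularForm EisensteinSeries UpperHalfPlane in
/-- The `q`-expansion of an Eisenstein series, in terms of `∑ σ_{k-1}(n) q^n`. -/
theorem E_qExpansion_eq {k : ℕ} (hk : 3 ≤ k) (hk2 : Even k) (β : ℂ)
    (hβ : -(2 * k / bernoulli k : ℂ) = β) :
    qExpansion 1 (E hk) =
      1 + PowerSeries.C β * PowerSeries.mk fun n => (sigmaPow (k - 1) n : ℂ) := by
  ext m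
  rw [E_qExpansion_coeff hk hk2, hβ, sigma_eq_sigmaPow]
  rcases eq_or_ne m 0 with rfl | hm
  · simp [sigmaPow]
  · simp [hm, PowerSeries.coeff_one]

theorem sigmaConv_coeff (s t n : ℕ) :
    ((PowerSeries.mk fun n => (sigmaPow s n : ℂ)) *
      PowerSeries.mk fun n => (sigmaPow t n : ℂ)).coeff n = (sigmaConv s t n : ℂ) := by
  simp [PowerSeries.coeff_mul, sigmaConv]

theorem discriminant_coeff_eq_sigmaConv (n : ℕ) (hn : 1 ≤ n) :
    (UpperHalfPlane.qExpansion 1 ModularForm.discriminant).coeff n =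
      200 / 3 * (sigmaConv 7 3 n : ℂ) - 147 * (sigmaConv 5 5 n : ℂ) + 5 / 18 * (sigmaPow 7 n : ℂ)
        + 7 / 12 * (sigmaPow 5 n : ℂ) + 5 / 36 * (sigmaPow 3 n : ℂ) := by
  have h := congrArg (PowerSeries.coeff n) discriminant_qExpansion
  rw [E_qExpansion_eq (by norm_num : 3 ≤ 4) ⟨2, rfl⟩ 240
      (by norm_num [show bernoulli 4 = -1 / 30 by decide +kernel]),
    E_qExpansion_eq (by norm_num : 3 ≤ 6) ⟨3, rfl⟩ (-504)
      (by norm_num [show bernoulli 6 = 1 / 42 by decide +kernel]),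
    E_qExpansion_eq (by norm_num : 3 ≤ 8) ⟨4, rfl⟩ 480
      (by norm_num [show bernoulli 8 = -1 / 30 by decide +kernel])] at h
  simp only [show 4 - 1 = 3 from rfl, show 6 - 1 = 5 from rfl, show 8 - 1 = 7 from rfl] at h
  have expand : ∀ (a b : ℂ) (f g : PowerSeries ℂ),
      ((1 + PowerSeries.C a * f) * (1 + PowerSeries.C b * g)).coeff n =
        a * f.coeff n + b * g.coeff n + a * b * (g * f).coeff n := by
    intro a b f g
    rw [show (1 + PowerSeries.C a * f) * (1 + PowerSeries.C b * g) =
      1 + PowerSeries.C a * f + PowerSeries.C b * g + PowerSeries.C (a * b) * (g * f) by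
        rw [map_mul]; ring]
    simp [-map_mul, PowerSeries.coeff_one, show n ≠ 0 by omega]
  rw [map_sub, expand, expand, sigmaConv_coeff, sigmaConv_coeff] at h
  simp only [PowerSeries.coeff_mk, PowerSeries.coeff_smul, smul_eq_mul] at h
  linear_combination h / 1728

theorem tau_eq_multiple_divisor_sums (n : ℕ) (hn : 1 ≤ n) :
    (ramanujanTau n : ℚ)
      = (200 / 3 : ℚ) * ((sigmaPow2 7 3 n : ℚ) + (sigmaPow2 3 7 n : ℚ))
        - 294 * (sigmaPow2 5 5 n : ℚ)
        - (1 / 396 : ℚ) * (sigmaPow 11 n : ℚ)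
        + (5 / 6 : ℚ) * (sigmaPow 7 n : ℚ)
        - (137 / 36 : ℚ) * (sigmaPow 5 n : ℚ)
        - (19 / 9 : ℚ) * (sigmaPow 3 n : ℚ)
        + (1205 / 198 : ℚ) * (sigmaPow 1 n : ℚ) := by
  have hτ := (qExpansion_discriminant_coeff n).symm.trans (discriminant_coeff_eq_sigmaConv n hn)
  have h : (ramanujanTau n : ℚ) =
      200 / 3 * (sigmaConv 7 3 n : ℚ) - 147 * (sigmaConv 5 5 n : ℚ) + 5 / 18 * (sigmaPow 7 n : ℚ)
        + 7 / 12 * (sigmaPow 5 n : ℚ) + 5 / 36 * (sigmaPow 3 n : ℚ) := by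
    apply Rat.cast_injective (α := ℂ)
    push_cast
    exact hτ
  rw [sigmaConv_eq_add, sigmaConv_eq_add] at h
  push_cast at h
  linear_combination h + quadSum_eq_combination n
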